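/- (Local SafeToOpen Lemma, part 4) In a regular run, let x be a track with significant moments 0 = t_0 < t_1 < t_2 < …, and let s(x,t) denote the condition: TrackStatus(x,t) = empty or t + d_open < Deadline(x,t). Then s(x,·) becomes true exactly at the moments t_{3i} with i > 0, that is, exactly at those moments when TrackStatus(x,·) becomes empty: for t > 0, s(x,t) holds while s(x,t−) fails if and only if t = t_{3i} for some i > 0. -/

import Mathlib

namespace RailCross

inductive TStat : Type
  | emp | coming | incrossing
deriving DecidableEq

inductive DirV : Type
  | opn | cls
deriving DecidableEq

inductive GateV : Type
  | opened | closed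
deriving DecidableEq

/-- `f` is piecewise constant on `[0, ∞)`: for every `τ > 0` there is a finite
partition `0 = s 0 < s 1 < … < s n = τ` such that `f` is constant on each open
subinterval `(s i, s (i+1))`. -/
def PWC {Y : Type*} (f : ℝ → Y) : Prop :=
  ∀ τ : ℝ, 0 < τ → ∃ n : ℕ, ∃ s : ℕ → ℝ,
    s 0 = 0 ∧ s n = τ ∧ (∀ i < n, s i < s (i + 1)) ∧
    (∀ i < n, ∀ a b : ℝ, s i < a → a < b → b < s (i + 1) → f a = f b)

/-- `v` is the right-hand value `f(t+)`: `f` is constantly `v` on some `(t, t+ε)`. -/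
def RightVal {Y : Type*} (f : ℝ → Y) (t : ℝ) (v : Y) : Prop :=
  ∃ ε : ℝ, 0 < ε ∧ ∀ u : ℝ, t < u → u < t + ε → f u = v

/-- `v` is the left-hand value `f(t−)` (for `t > 0`): `f` is constantly `v` on some `(t-ε, t)`. -/
def LeftVal {Y : Type*} (f : ℝ → Y) (t : ℝ) (v : Y) : Prop :=
  ∃ ε : ℝ, 0 < ε ∧ ε ≤ t ∧ ∀ u : ℝ, t - ε < u → u < t → f u = v

/-- `tm` is the (finite or infinite) increasing sequence of significant moments of a
track with status function `f`; a finite sequence is encoded by letting `tm` take the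
value `⊤ = ∞` from some point on. -/
structure TrainMotion (dmin dmax : ℝ) (f : ℝ → TStat) (tm : ℕ → EReal) : Prop where
  zero : tm 0 = 0
  mono : Monotone tm
  strict : ∀ i, tm i ≠ ⊤ → tm i < tm (i + 1)
  last_div : ∀ k, tm k ≠ ⊤ → tm (k + 1) = ⊤ → 3 ∣ k
  status_empty : ∀ i : ℕ, ∀ u : ℝ, tm (3 * i) ≤ (u : EReal) → (u : EReal) < tm (3 * i + 1) →
    f u = TStat.emp
  status_coming : ∀ i : ℕ, ∀ u : ℝ, tm (3 * i + 1) ≤ (u : EReal) → (u : EReal) < tm (3 * i + 2) →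
    f u = TStat.coming
  status_cross : ∀ i : ℕ, ∀ u : ℝ, tm (3 * i + 2) ≤ (u : EReal) → (u : EReal) < tm (3 * i + 3) →
    f u = TStat.incrossing
  gap : ∀ i : ℕ, ∀ a b : ℝ, tm (3 * i + 1) = (a : EReal) → tm (3 * i + 2) = (b : EReal) →
    dmin ≤ b - a ∧ b - a ≤ dmax

/-- `SafeToOpen(t)`: every track is empty or its deadline is more than `dopen` away. -/
def SafeToOpen {Tracks : Type*} (dopen : ℝ) (trackStatus : Tracks → ℝ → TStat)
    (deadline : Tracks → ℝ → EReal) (t : ℝ) : Prop :=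
  ∀ x : Tracks, trackStatus x t = TStat.emp ∨ ((t + dopen : ℝ) : EReal) < deadline x t

/-- A regular run of the railroad-crossing evolving algebra.  `WaitTime = dmin - dclose`. -/
structure RegularRun (Tracks : Type*) (dmin dmax dopen dclose : ℝ) where
  trackStatus : Tracks → ℝ → TStat
  deadline : Tracks → ℝ → EReal
  dir : ℝ → DirV
  gate : ℝ → GateV
  /-- the right-hand value `Deadline(x, t+)` -/
  deadlinePlus : Tracks → ℝ → EReal
  /-- the right-hand value `Dir(t+)` -/
  dirPlus : ℝ → DirV
  /-- the right-hand value `GateStatus(t+)` -/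
  gatePlus : ℝ → GateV
  pwc_ts : ∀ x, PWC (trackStatus x)
  pwc_dl : ∀ x, PWC (deadline x)
  pwc_dir : PWC dir
  pwc_gate : PWC gate
  dlPlus_spec : ∀ x, ∀ t : ℝ, 0 ≤ t → RightVal (deadline x) t (deadlinePlus x t)
  dirPlus_spec : ∀ t : ℝ, 0 ≤ t → RightVal dir t (dirPlus t)
  gatePlus_spec : ∀ t : ℝ, 0 ≤ t → RightVal gate t (gatePlus t)
  dl_left : ∀ x, ∀ t : ℝ, 0 < t → LeftVal (deadline x) t (deadline x t)
  dir_left : ∀ t : ℝ, 0 < t → LeftVal dir t (dir t)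
  gate_left : ∀ t : ℝ, 0 < t → LeftVal gate t (gate t)
  trainMotion : ∀ x, ∃ tm : ℕ → EReal, TrainMotion dmin dmax (trackStatus x) tm
  dl_init : ∀ x, deadline x 0 = ⊤
  dir_init : dir 0 = DirV.opn
  gate_init : gate 0 = GateV.opened
  dl_step_coming : ∀ x, ∀ t : ℝ, 0 ≤ t → trackStatus x t = TStat.coming → deadline x t = ⊤ →
    deadlinePlus x t = ((t + (dmin - dclose) : ℝ) : EReal)
  dl_step_empty : ∀ x, ∀ t : ℝ, 0 ≤ t → trackStatus x t = TStat.emp → deadline x t ≠ ⊤ →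
    deadlinePlus x t = ⊤
  dl_step_other : ∀ x, ∀ t : ℝ, 0 ≤ t →
    ¬(trackStatus x t = TStat.coming ∧ deadline x t = ⊤) →
    ¬(trackStatus x t = TStat.emp ∧ deadline x t ≠ ⊤) →
    deadlinePlus x t = deadline x t
  dir_step_close : ∀ t : ℝ, 0 ≤ t → (∃ x, deadline x t = (t : EReal)) → dirPlus t = DirV.cls
  dir_step_open : ∀ t : ℝ, 0 ≤ t → (∀ x, deadline x t ≠ (t : EReal)) → dir t = DirV.cls →
    SafeToOpen dopen trackStatus deadline t → dirPlus t = DirV.opn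
  dir_step_other : ∀ t : ℝ, 0 ≤ t → (∀ x, deadline x t ≠ (t : EReal)) →
    ¬(dir t = DirV.cls ∧ SafeToOpen dopen trackStatus deadline t) → dirPlus t = dir t
  gate_step : ∀ t : ℝ, 0 ≤ t →
    gatePlus t = gate t ∨ (dir t = DirV.opn ∧ gatePlus t = GateV.opened) ∨
      (dir t = DirV.cls ∧ gatePlus t = GateV.closed)
  gate_close_bound : ∀ t : ℝ, 0 ≤ t →
    ¬(∀ u ∈ Set.Ioo t (t + dclose), dir u = DirV.cls ∧ gate u = GateV.opened)
  gate_open_bound : ∀ t : ℝ, 0 ≤ t →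
    ¬(∀ u ∈ Set.Ioo t (t + dopen), dir u = DirV.opn ∧ gate u = GateV.closed)

/-- A left-continuous `f` with right-hand value `v` at `a`, which keeps the value `v` to the right
of every point where it is attained, is constantly `v` on `(a, b]`. -/
theorem eq_of_rightVal_of_propagates {Y : Type*} {f : ℝ → Y} {a b : ℝ} {v : Y}
    (ha : RightVal f a v)
    (hl : ∀ t, a < t → t ≤ b → LeftVal f t (f t))
    (hr : ∀ t, a < t → t < b → f t = v → RightVal f t v)
    {u : ℝ} (hau : a < u) (hub : u ≤ b) : f u = v := by
  by_contra hu
  let S : Set ℝ := {w | a < w ∧ w ≤ b ∧ f w ≠ v}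
  have hS : u ∈ S := ⟨hau, hub, hu⟩
  have hbdd : BddBelow S := ⟨a, fun w hw => hw.1.le⟩
  have hcb : sInf S ≤ b := (csInf_le hbdd hS).trans hub
  have hac : a < sInf S := by
    obtain ⟨ε, hε, h⟩ := ha
    have : a + ε ≤ sInf S := le_csInf ⟨u, hS⟩ fun w hw => by
      by_contra! hlt
      exact hw.2.2 (h w hw.1 hlt)
    linarith
  have hbelow : ∀ w, a < w → w < sInf S → f w = v := fun w haw hwc => by
    by_contra hw
    exact absurd (csInf_le hbdd (show w ∈ S from ⟨haw, hwc.le.trans hcb, hw⟩)) hwc.not_ge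
  have hc : f (sInf S) = v := by
    obtain ⟨ε, hε, -, h⟩ := hl _ hac hcb
    obtain ⟨w, hw1, hw2⟩ := exists_between (max_lt hac (show sInf S - ε < sInf S by linarith))
    rw [← h w ((le_max_right _ _).trans_lt hw1) hw2]
    exact hbelow w ((le_max_left _ _).trans_lt hw1) hw2
  rcases hcb.eq_or_lt with heq | hlt
  · have := csInf_le hbdd hS
    exact hu (by rw [show u = sInf S by linarith, hc])
  · obtain ⟨ε, hε, h⟩ := hr _ hac hlt hc
    have : sInf S + ε ≤ sInf S := le_csInf ⟨u, hS⟩ fun w hw => by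
      by_contra! hlt'
      rcases (csInf_le hbdd hw).eq_or_lt with heq | hlt''
      · exact hw.2.2 (heq ▸ hc)
      · exact hw.2.2 (h w hlt'' hlt')
    linarith

namespace TrainMotion

variable {dmin dmax : ℝ} {f : ℝ → TStat} {tm : ℕ → EReal}

theorem exists_real (h : TrainMotion dmin dmax f tm) {k : ℕ} (hk : tm k ≠ ⊤) :
    ∃ a : ℝ, 0 ≤ a ∧ tm k = a := by
  have h0 : 0 ≤ tm k := h.zero ▸ h.mono (Nat.zero_le k)
  lift tm k to ℝ using ⟨hk, fun hb => by simp [hb] at h0⟩ with a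
  exact ⟨a, by exact_mod_cast h0, rfl⟩

theorem ne_top_succ (h : TrainMotion dmin dmax f tm) {k : ℕ} (hk : tm k ≠ ⊤) (hd : ¬ 3 ∣ k) :
    tm (k + 1) ≠ ⊤ :=
  fun hs => hd (h.last_div k hk hs)

/-- The significant moments of a nontrivial cycle, as real numbers. -/
theorem exists_cycle (h : TrainMotion dmin dmax f tm) {i : ℕ} (hi : tm (3 * i + 1) ≠ ⊤) :
    ∃ a b c d : ℝ, 0 ≤ a ∧ a < b ∧ b + dmin ≤ c ∧ c < d ∧ b < c ∧
      tm (3 * i) = a ∧ tm (3 * i + 1) = b ∧ tm (3 * i + 2) = c ∧ tm (3 * i + 3) = d := by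
  have hi2 : tm (3 * i + 2) ≠ ⊤ := h.ne_top_succ hi (by omega)
  have hi3 : tm (3 * i + 3) ≠ ⊤ := h.ne_top_succ hi2 (by omega)
  have hi0 : tm (3 * i) ≠ ⊤ := fun h0 => hi (top_le_iff.1 (h0 ▸ h.mono (Nat.le_succ _)))
  obtain ⟨a, ha0, ha⟩ := h.exists_real hi0
  obtain ⟨b, -, hb⟩ := h.exists_real hi
  obtain ⟨c, -, hc⟩ := h.exists_real hi2
  obtain ⟨d, -, hd⟩ := h.exists_real hi3
  have hab := h.strict _ hi0
  have hbc := h.strict _ hi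
  have hcd := h.strict _ hi2
  rw [ha, hb] at hab
  rw [hb, hc] at hbc
  rw [hc, hd] at hcd
  have := (h.gap i b c hb hc).1
  exact ⟨a, b, c, d, ha0, by exact_mod_cast hab, by linarith, by exact_mod_cast hcd,
    by exact_mod_cast hbc, ha, hb, hc, hd⟩

theorem mul_le_moment (h : TrainMotion dmin dmax f tm) (n : ℕ) :
    ((n * dmin : ℝ) : EReal) ≤ tm (3 * n) := by
  induction n with
  | zero => simp [h.zero]
  | succ n ih =>
    by_cases htop : tm (3 * n + 1) = ⊤
    · have : tm (3 * (n + 1)) = ⊤ := top_le_iff.1 (htop ▸ h.mono (by omega))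
      simp [this]
    · obtain ⟨a, b, c, d, -, hab, hbc, hcd, -, ha, -, -, hd⟩ := h.exists_cycle htop
      rw [ha, EReal.coe_le_coe_iff] at ih
      rw [show 3 * (n + 1) = 3 * n + 3 by ring, hd, EReal.coe_le_coe_iff]
      push_cast
      linarith

theorem exists_mem_cycle (h : TrainMotion dmin dmax f tm) (hdmin : 0 < dmin) {t : ℝ}
    (ht : 0 ≤ t) : ∃ i : ℕ, tm (3 * i) ≤ t ∧ (t : EReal) < tm (3 * i + 3) := by
  have key : ∀ n : ℕ, (t : EReal) < tm (3 * n) →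
      ∃ i : ℕ, tm (3 * i) ≤ t ∧ (t : EReal) < tm (3 * i + 3) := by
    intro n
    induction n with
    | zero =>
      intro hn
      rw [mul_zero, h.zero] at hn
      exact absurd (EReal.coe_nonneg.2 ht) hn.not_ge
    | succ n ih =>
      intro hn
      rcases lt_or_ge (t : EReal) (tm (3 * n)) with hlt | hge
      · exact ih hlt
      · exact ⟨n, hge, hn⟩
  obtain ⟨n, hn⟩ := exists_nat_gt (t / dmin)
  refine key n (lt_of_lt_of_le ?_ (h.mul_le_moment n))
  rw [div_lt_iff₀ hdmin] at hn
  exact_mod_cast hn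

end TrainMotion

namespace RegularRun

variable {Tracks : Type*} {dmin dmax dopen dclose : ℝ}
  (R : RegularRun Tracks dmin dmax dopen dclose) {x : Tracks} {tm : ℕ → EReal}

theorem deadline_eq_top (htm : TrainMotion dmin dmax (R.trackStatus x) tm) {i : ℕ} {a u : ℝ}
    (ha : tm (3 * i) = a) (ha0 : 0 ≤ a) (hau : a < u) (hu : (u : EReal) ≤ tm (3 * i + 1)) :
    R.deadline x u = ⊤ := by
  have hplus : ∀ t : ℝ, a ≤ t → t < u → RightVal (R.deadline x) t ⊤ := by
    intro t hat htu
    have hemp : R.trackStatus x t = TStat.emp :=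
      htm.status_empty i t (by rw [ha]; exact_mod_cast hat)
        (lt_of_lt_of_le (by exact_mod_cast htu) hu)
    have hspec := R.dlPlus_spec x t (ha0.trans hat)
    by_cases hd : R.deadline x t = ⊤
    · rwa [R.dl_step_other x t (ha0.trans hat) (by simp [hemp]) (by simp [hd]), hd] at hspec
    · rwa [R.dl_step_empty x t (ha0.trans hat) hemp hd] at hspec
  exact eq_of_rightVal_of_propagates (hplus a le_rfl hau)
    (fun t hat _ => R.dl_left x t (ha0.trans_lt hat)) (fun t hat htu _ => hplus t hat.le htu)
    hau le_rfl

theorem trackStatus_ne_emp (htm : TrainMotion dmin dmax (R.trackStatus x) tm) {i : ℕ} {u : ℝ}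
    (h1 : tm (3 * i + 1) ≤ u) (h2 : (u : EReal) < tm (3 * i + 3)) :
    R.trackStatus x u ≠ TStat.emp := by
  rcases lt_or_ge (u : EReal) (tm (3 * i + 2)) with h | h
  · simp [htm.status_coming i u h1 h]
  · simp [htm.status_cross i u h h2]

theorem deadline_eq_coe (htm : TrainMotion dmin dmax (R.trackStatus x) tm) {i : ℕ} {b u : ℝ}
    (hb : tm (3 * i + 1) = b) (hbu : b < u) (hu : (u : EReal) ≤ tm (3 * i + 3)) :
    R.deadline x u = ((b + (dmin - dclose) : ℝ) : EReal) := by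
  have hne : tm (3 * i + 1) ≠ ⊤ := by simp [hb]
  obtain ⟨a, b', c, d, ha0, hab, -, -, hbc, ha, hb', hc, hd⟩ := htm.exists_cycle hne
  obtain rfl : b' = b := by rw [hb] at hb'; exact_mod_cast hb'.symm
  have hb0 : 0 ≤ b' := ha0.trans hab.le
  have htop : R.deadline x b' = ⊤ := R.deadline_eq_top htm ha ha0 hab hb.ge
  have hcoming : R.trackStatus x b' = TStat.coming :=
    htm.status_coming i b' hb.le (by rw [hc]; exact_mod_cast hbc)
  refine eq_of_rightVal_of_propagates
    (R.dl_step_coming x b' hb0 hcoming htop ▸ R.dlPlus_spec x b' hb0)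
    (fun t hbt _ => R.dl_left x t (hb0.trans_lt hbt)) (fun t hbt htu hval => ?_) hbu le_rfl
  have hemp : R.trackStatus x t ≠ TStat.emp :=
    R.trackStatus_ne_emp htm (by rw [hb]; exact_mod_cast hbt.le)
      (lt_of_lt_of_le (by exact_mod_cast htu) hu)
  have ht0 : 0 ≤ t := hb0.trans hbt.le
  have hspec := R.dlPlus_spec x t ht0
  rwa [R.dl_step_other x t ht0 (by rw [hval]; exact fun h => EReal.coe_ne_top _ h.2)
    (fun h => hemp h.1), hval] at hspec

end RegularRun

theorem local_safe_to_open_4 {Tracks : Type*} [Fintype Tracks] [Nonempty Tracks]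
    {dmin dmax dopen dclose : ℝ}
    (hdmin : 0 < dmin) (hdmax : 0 < dmax) (hdopen : 0 < dopen) (hdclose : 0 < dclose)
    (hcm : dclose < dmin) (hmm : dmin ≤ dmax)
    (R : RegularRun Tracks dmin dmax dopen dclose)
    (x : Tracks) (tm : ℕ → EReal) (htm : TrainMotion dmin dmax (R.trackStatus x) tm) :
    ∀ t : ℝ, 0 < t →
      (((R.trackStatus x t = TStat.emp ∨ ((t + dopen : ℝ) : EReal) < R.deadline x t) ∧
          (∃ ε : ℝ, 0 < ε ∧ ε ≤ t ∧ ∀ u : ℝ, t - ε < u → u < t →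
            ¬(R.trackStatus x u = TStat.emp ∨ ((u + dopen : ℝ) : EReal) < R.deadline x u))) ↔
        ∃ i : ℕ, 0 < i ∧ tm (3 * i) = (t : EReal)) := by
  intro t ht
  constructor
  · rintro ⟨hs, ε, hε, -, hfail⟩
    have hleft : ∀ a : ℝ, a < t → ∃ u, a < u ∧ u < t ∧
        ¬(R.trackStatus x u = TStat.emp ∨ ((u + dopen : ℝ) : EReal) < R.deadline x u) := by
      intro a hat
      obtain ⟨u, hu1, hu2⟩ := exists_between (max_lt hat (show t - ε < t by linarith))
      exact ⟨u, (le_max_left _ _).trans_lt hu1, hu2,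
        hfail u ((le_max_right _ _).trans_lt hu1) hu2⟩
    obtain ⟨i, hi, hi3⟩ := htm.exists_mem_cycle hdmin ht.le
    obtain ⟨a, ha0, ha⟩ := htm.exists_real (k := 3 * i) (hi.trans_lt (EReal.coe_lt_top t)).ne
    have hat : a ≤ t := by rw [ha] at hi; exact_mod_cast hi
    rcases hat.eq_or_lt with rfl | hat
    · refine ⟨i, Nat.pos_of_ne_zero ?_, ha⟩
      rintro rfl
      rw [mul_zero, htm.zero] at ha
      exact ht.ne (by exact_mod_cast ha)
    exfalso
    rcases le_or_gt (t : EReal) (tm (3 * i + 1)) with h1 | h1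
    · obtain ⟨u, hau, hut, hu⟩ := hleft a hat
      exact hu (Or.inl (htm.status_empty i u (by rw [ha]; exact_mod_cast hau.le)
        (lt_of_lt_of_le (by exact_mod_cast hut) h1)))
    · obtain ⟨b, -, hb⟩ := htm.exists_real (k := 3 * i + 1) h1.ne_top
      have hbt : b < t := by rw [hb] at h1; exact_mod_cast h1
      have hdl := hs.resolve_left (R.trackStatus_ne_emp htm h1.le hi3)
      obtain ⟨u, hbu, hut, hu⟩ := hleft b hbt
      refine hu (Or.inr ?_)
      rw [R.deadline_eq_coe htm hb hbt hi3.le, EReal.coe_lt_coe_iff] at hdl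
      rw [R.deadline_eq_coe htm hb hbu ((EReal.coe_le_coe_iff.2 hut.le).trans hi3.le),
        EReal.coe_lt_coe_iff]
      linarith
  · rintro ⟨j, hj, htj⟩
    obtain ⟨i, rfl⟩ : ∃ i, j = i + 1 := ⟨j - 1, by omega⟩
    have htne : tm (3 * (i + 1)) ≠ ⊤ := by simp [htj]
    have hne : tm (3 * i + 1) ≠ ⊤ := fun h => htne (top_le_iff.1 (h ▸ htm.mono (by omega)))
    obtain ⟨a, b, c, d, ha0, hab, hbc, hcd, hbc', -, hb, hc, hd⟩ := htm.exists_cycle hne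
    obtain rfl : d = t := by
      rw [show 3 * (i + 1) = 3 * i + 3 by ring, hd] at htj
      exact_mod_cast htj
    refine ⟨Or.inl (htm.status_empty (i + 1) d htj.le (htj ▸ htm.strict _ htne)),
      d - c, by linarith, by linarith, fun u hu hud => ?_⟩
    rw [sub_sub_cancel] at hu
    have hud' : (u : EReal) < tm (3 * i + 3) := by rw [hd]; exact_mod_cast hud
    rintro (h | h)
    · exact R.trackStatus_ne_emp htm (by rw [hb]; exact_mod_cast (hbc'.trans hu).le) hud' h
    · rw [R.deadline_eq_coe htm hb (hbc'.trans hu) hud'.le, EReal.coe_lt_coe_iff] at h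
      linarith

end RailCross
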